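/- Assume * is not the identity map, A(g,h) = gh, B equals (as a map G × G → G) one of (g,h) ↦ gh, g*h, hg, hg*, C equals one of (g,h) ↦ gh, hg, and D equals (g,h) ↦ g0·ε(g,h) for one of the eight basic maps ε. Then the loop L = Q(G; A, B, C, D) is a left Bol loop, i.e. satisfies x∘(y∘(x∘z)) = (x∘(y∘x))∘z for all x, y, z ∈ L, if and only if L is Moufang (satisfies x∘(y∘(x∘z)) = ((x∘y)∘x)∘z), or [g² ∈ Z(G) for every g and (B, C, D) equals one of ((g,h)↦gh, (g,h)↦hg, (g,h)↦g0·hg), ((g,h)↦g*h, (g,h)↦gh, (g,h)↦g0·g*h)], or [G is commutative, (x·x)* = x·x for every x ∈ G, and (B, C, D) equals one of ((g,h)↦gh, (g,h)↦gh, (g,h)↦g0·g*h), ((g,h)↦g*h, (g,h)↦gh, (g,h)↦g0·gh)], or [g² ∈ Z(G) for every g, (x·x)* = x·x for every x ∈ G, and (B, C, D) equals one of ((g,h)↦gh, (g,h)↦gh, (g,h)↦g0·g*h), ((g,h)↦gh, (g,h)↦hg, (g,h)↦g0·h·g*), ((g,h)↦g*h, (g,h)↦gh, (g,h)↦g0·gh),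 ((g,h)↦g*h, (g,h)↦hg, (g,h)↦g0·hg)] (all equalities of B, C, D as maps). -/

import Mathlib

open Function

/-- Multiplication on the disjoint union `G ⊕ G` (first summand: `G`, second: `Gu`)
determined by four maps `A B C D : G → G → G`. -/
def Qmul {G : Type*} (A B C D : G → G → G) : G ⊕ G → G ⊕ G → G ⊕ G
  | Sum.inl g, Sum.inl h => Sum.inl (A g h)
  | Sum.inl g, Sum.inr h => Sum.inr (B g h)
  | Sum.inr g, Sum.inl h => Sum.inr (C g h)
  | Sum.inr g, Sum.inr h => Sum.inl (D g h)

/-- A magma is a loop with identity `e` if `e` is a two-sided identity and all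
left and right translations are bijections. -/
def IsLoopWith {α : Type*} (mul : α → α → α) (e : α) : Prop :=
  (∀ x, mul e x = x) ∧ (∀ x, mul x e = x) ∧
  (∀ a, Function.Bijective fun x => mul a x) ∧
  (∀ a, Function.Bijective fun x => mul x a)

/-- The eight basic maps `G × G → G` built from `*` (here written `s`). -/
def IsBasic {G : Type*} [Group G] (s : G → G) (ε : G → G → G) : Prop :=
  ε = (fun g h => g * h) ∨ ε = (fun g h => g * s h) ∨
  ε = (fun g h => s g * h) ∨ ε = (fun g h => s g * s h) ∨
  ε = (fun g h => h * g) ∨ ε = (fun g h => h * s g) ∨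
  ε = (fun g h => s h * g) ∨ ε = (fun g h => s h * s g)

/-- A map of the form `(g,h) ↦ g0 ^ m * ε (g,h)` for a basic map `ε`. -/
def IsG0Form {G : Type*} [Group G] (s : G → G) (g0 : G) (X : G → G → G) : Prop :=
  ∃ (m : ℤ) (ε : G → G → G), IsBasic s ε ∧ X = fun g h => g0 ^ m * ε g h

/-- The left Bol law for `Qmul (· * ·) B C D`, split according to which of the three
arguments lie in the second copy of `G`. -/
structure LeftBolComponents {G : Type*} [Group G] (B C D : G → G → G) : Prop where
  llr : ∀ g h k, B g (B h (B g k)) = B (g * (h * g)) k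
  lrl : ∀ g h k, B g (C h (g * k)) = C (B g (C h g)) k
  lrr : ∀ g h k, g * D h (B g k) = D (B g (C h g)) k
  rll : ∀ g h k, D g (B h (C g k)) = D g (B h g) * k
  rlr : ∀ g h k, C g (h * D g k) = B (D g (B h g)) k
  rrl : ∀ g h k, C g (D h (C g k)) = C (C g (D h g)) k
  rrr : ∀ g h k, D g (C h (D g k)) = D (C g (D h g)) k

theorem leftBol_Qmul_iff {G : Type*} [Group G] (B C D : G → G → G) :
    (∀ x y z, Qmul (fun g h => g * h) B C D x (Qmul (fun g h => g * h) B C D y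
        (Qmul (fun g h => g * h) B C D x z)) =
      Qmul (fun g h => g * h) B C D (Qmul (fun g h => g * h) B C D x
        (Qmul (fun g h => g * h) B C D y x)) z) ↔ LeftBolComponents B C D := by
  constructor
  · intro H
    exact
      { llr := fun g h k => Sum.inr_injective (H (.inl g) (.inl h) (.inr k))
        lrl := fun g h k => Sum.inr_injective (H (.inl g) (.inr h) (.inl k))
        lrr := fun g h k => Sum.inl_injective (H (.inl g) (.inr h) (.inr k))
        rll := fun g h k => Sum.inl_injective (H (.inr g) (.inl h) (.inl k))
        rlr := fun g h k => Sum.inr_injective (H (.inr g) (.inl h) (.inr k))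
        rrl := fun g h k => Sum.inr_injective (H (.inr g) (.inr h) (.inl k))
        rrr := fun g h k => Sum.inl_injective (H (.inr g) (.inr h) (.inr k)) }
  · rintro H (g | g) (h | h) (k | k)
    · simp [Qmul, mul_assoc]
    · exact congrArg Sum.inr (H.llr g h k)
    · exact congrArg Sum.inr (H.lrl g h k)
    · exact congrArg Sum.inl (H.lrr g h k)
    · exact congrArg Sum.inl (H.rll g h k)
    · exact congrArg Sum.inr (H.rlr g h k)
    · exact congrArg Sum.inr (H.rrl g h k)
    · exact congrArg Sum.inl (H.rrr g h k)

/-- A left Bol magma `Qmul (· * ·) B C D` that is flexible satisfies the Moufang law. -/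
theorem moufang_Qmul_of_flexible {G : Type*} [Group G] {B C D : G → G → G}
    (H : LeftBolComponents B C D)
    (hlr : ∀ g h, C (B g h) g = B g (C h g))
    (hrl : ∀ g h, D (C g h) g = D g (B h g))
    (hrr : ∀ g h, B (D g h) g = C g (D h g)) :
    ∀ x y z, Qmul (fun g h => g * h) B C D x (Qmul (fun g h => g * h) B C D y
        (Qmul (fun g h => g * h) B C D x z)) =
      Qmul (fun g h => g * h) B C D (Qmul (fun g h => g * h) B C D
        (Qmul (fun g h => g * h) B C D x y) x) z := by
  intro x y z
  rw [(leftBol_Qmul_iff B C D).2 H x y z]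
  congr 1
  rcases x with g | g <;> rcases y with h | h <;> simp [Qmul, mul_assoc, hlr, hrl, hrr]

/-- The Moufang law `x(y(xz)) = ((xy)x)z` implies the left Bol law in the presence of a
right identity. -/
theorem leftBol_of_moufang {α : Type*} {mul : α → α → α} {e : α} (he : ∀ x, mul x e = x)
    (H : ∀ x y z, mul x (mul y (mul x z)) = mul (mul (mul x y) x) z) (x y z : α) :
    mul x (mul y (mul x z)) = mul (mul x (mul y x)) z := by
  have hflex := H x y e
  rw [he, he] at hflex
  rw [H, hflex]

section CentralNorm

variable {G : Type*} [Group G] {s : G → G} {g0 : G}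

theorem antiautomorphism_one (hanti : ∀ g h, s (g * h) = s h * s g) : s 1 = 1 := by
  have h := hanti 1 1
  rw [mul_one] at h
  exact mul_eq_left.1 h.symm

theorem star_mul_self_comm (hcen : ∀ g, g * s g ∈ Subgroup.center G) (g : G) :
    s g * g = g * s g := by
  have h := Subgroup.mem_center_iff.1 (hcen g) g
  rw [mul_assoc] at h
  exact (mul_left_cancel h).symm

theorem star_mul_self_central (hcen : ∀ g, g * s g ∈ Subgroup.center G) (g x : G) :
    x * (s g * g) = s g * g * x := by
  rw [star_mul_self_comm hcen]
  exact Subgroup.mem_center_iff.1 (hcen g) x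

theorem sq_mem_center_of_swap (hcen : ∀ g, g * s g ∈ Subgroup.center G) {g : G}
    (h : ∀ x, g * (x * s g) = s g * (x * g)) : g ^ 2 ∈ Subgroup.center G := by
  refine Subgroup.mem_center_iff.2 fun x => ?_
  have hx := congrArg (· * g) (h x)
  have hc := star_mul_self_central hcen g x
  simp only [mul_assoc] at hx hc
  rw [hc, ← mul_assoc, ← star_mul_self_comm hcen, mul_assoc] at hx
  simpa only [pow_two, mul_assoc] using (mul_left_cancel hx).symm

theorem central_comm {c : G} (hc : c ∈ Subgroup.center G) (x : G) : x * c = c * x :=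
  Subgroup.mem_center_iff.1 hc x

theorem central_left_comm {c : G} (hc : c ∈ Subgroup.center G) (x y : G) :
    x * (c * y) = c * (x * y) := by
  rw [← mul_assoc, central_comm hc, mul_assoc]

theorem sq_comm (hsq : ∀ g : G, g ^ 2 ∈ Subgroup.center G) (g x : G) :
    x * (g * g) = g * (g * x) := by
  simpa only [pow_two, mul_assoc] using central_comm (hsq g) x

theorem sq_left_comm (hsq : ∀ g : G, g ^ 2 ∈ Subgroup.center G) (g x y : G) :
    x * (g * (g * y)) = g * (g * (x * y)) := by
  simpa only [pow_two, mul_assoc] using central_left_comm (hsq g) x y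

/-- If both `g * s g` and `g ^ 2` are central, then `s g` is a central multiple of `g`. -/
theorem exists_star_eq_central_mul (hcen : ∀ g, g * s g ∈ Subgroup.center G)
    (hsq : ∀ g : G, g ^ 2 ∈ Subgroup.center G) (g : G) :
    ∃ c ∈ Subgroup.center G, s g = c * g := by
  refine ⟨(g ^ 2)⁻¹ * (g * s g), mul_mem (inv_mem (hsq g)) (hcen g), ?_⟩
  rw [← star_mul_self_comm hcen, mul_assoc, mul_assoc, ← pow_two,
    Subgroup.mem_center_iff.1 (hsq g) (s g), inv_mul_cancel_left]

theorem exists_star_eq_involutive_central_mul (hanti : ∀ g h, s (g * h) = s h * s g)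
    (hcen : ∀ g, g * s g ∈ Subgroup.center G) (hsq : ∀ g : G, g ^ 2 ∈ Subgroup.center G)
    (hsx : ∀ x, s (x * x) = x * x) (g : G) :
    ∃ c ∈ Subgroup.center G, s g = c * g ∧ ∀ x, c * (c * x) = x := by
  obtain ⟨c, hc, hs⟩ := exists_star_eq_central_mul hcen hsq g
  refine ⟨c, hc, hs, fun x => ?_⟩
  have h := hsx g
  rw [hanti, hs, mul_assoc, central_left_comm hc, ← mul_assoc] at h
  rw [← mul_assoc, mul_eq_right.1 h, one_mul]

set_option linter.unusedSimpArgs false in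
theorem leftBolComponents_mul_swap_swap
    (hg0 : g0 ∈ Subgroup.center G)
    (hsq : ∀ g : G, g ^ 2 ∈ Subgroup.center G) :
    LeftBolComponents (fun g h : G => g * h) (fun g h : G => h * g)
      (fun g h : G => g0 * (h * g)) := by
  have hz := fun x => central_comm hg0 x
  have hz' := fun x y => central_left_comm hg0 x y
  have h2 := fun g x => sq_comm hsq g x
  have h2' := fun g x y => sq_left_comm hsq g x y
  constructor <;> intro g h k <;>
    simp only [mul_assoc, hz h, hz k, hz' g, hz' h, hz' k, h2 g h, h2 g k, h2' g h, h2' g k]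

set_option linter.unusedSimpArgs false in
theorem leftBolComponents_starMul_mul_starMul
    (hinv : ∀ g, s (s g) = g) (hanti : ∀ g h, s (g * h) = s h * s g)
    (hcen : ∀ g, g * s g ∈ Subgroup.center G)
    (hg0 : g0 ∈ Subgroup.center G) (hg0s : s g0 = g0)
    (hsq : ∀ g : G, g ^ 2 ∈ Subgroup.center G) :
    LeftBolComponents (fun g h : G => s g * h) (fun g h : G => g * h)
      (fun g h : G => g0 * (s g * h)) := by
  have hz := fun x => central_comm hg0 x
  have hz' := fun x y => central_left_comm hg0 x y
  have h2 := fun g x => sq_comm hsq g x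
  have h2' := fun g x y => sq_left_comm hsq g x y
  constructor <;> intro g h k <;>
    obtain ⟨c, hc, hs⟩ := exists_star_eq_central_mul hcen hsq g <;>
    have hw := (fun x => central_comm hc x) <;>
    have hw' := (fun x y => central_left_comm hc x y) <;>
    (try simp only [hanti, hinv, hg0s]) <;>
    (try simp only [mul_assoc, hs]) <;>
    simp only [hz g, hz h, hz k, hz (s h), hz' g, hz' h, hz' k, hz' (s h), hz' c, hw g, hw h, hw k,
      hw (s h), hw' g, hw' h, hw' k, hw' (s h), h2 g h, h2 g k, h2 g (s h), h2' g h, h2' g k,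
      h2' g (s h)]

set_option linter.unusedSimpArgs false in
theorem leftBolComponents_mul_mul_starMul
    (hinv : ∀ g, s (s g) = g) (hanti : ∀ g h, s (g * h) = s h * s g)
    (hcen : ∀ g, g * s g ∈ Subgroup.center G)
    (hg0 : g0 ∈ Subgroup.center G) (hg0s : s g0 = g0)
    (hsq : ∀ g : G, g ^ 2 ∈ Subgroup.center G) (hsx : ∀ x, s (x * x) = x * x) :
    LeftBolComponents (fun g h : G => g * h) (fun g h : G => g * h)
      (fun g h : G => g0 * (s g * h)) := by
  have hz := fun x => central_comm hg0 x
  have hz' := fun x y => central_left_comm hg0 x y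
  have h2 := fun g x => sq_comm hsq g x
  have h2' := fun g x y => sq_left_comm hsq g x y
  constructor <;> intro g h k <;>
    obtain ⟨c, hc, hs, hcc⟩ := exists_star_eq_involutive_central_mul hanti hcen hsq hsx g <;>
    have hw := (fun x => central_comm hc x) <;>
    have hw' := (fun x y => central_left_comm hc x y) <;>
    (try simp only [hanti, hinv, hg0s]) <;>
    (try simp only [mul_assoc, hs]) <;>
    simp only [hcc, hz g, hz h, hz k, hz (s h), hz' g, hz' h, hz' k, hz' (s h), hz' c, hw g, hw h, hw k,
      hw (s h), hw' g, hw' h, hw' k, hw' (s h), h2 g h, h2 g k, h2 g (s h), h2' g h, h2' g k,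
      h2' g (s h)]

set_option linter.unusedSimpArgs false in
theorem leftBolComponents_mul_swap_swapStar
    (hinv : ∀ g, s (s g) = g) (hanti : ∀ g h, s (g * h) = s h * s g)
    (hcen : ∀ g, g * s g ∈ Subgroup.center G)
    (hg0 : g0 ∈ Subgroup.center G) (hg0s : s g0 = g0)
    (hsq : ∀ g : G, g ^ 2 ∈ Subgroup.center G) (hsx : ∀ x, s (x * x) = x * x) :
    LeftBolComponents (fun g h : G => g * h) (fun g h : G => h * g)
      (fun g h : G => g0 * (h * s g)) := by
  have hz := fun x => central_comm hg0 x
  have hz' := fun x y => central_left_comm hg0 x y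
  have h2 := fun g x => sq_comm hsq g x
  have h2' := fun g x y => sq_left_comm hsq g x y
  constructor <;> intro g h k <;>
    obtain ⟨c, hc, hs, hcc⟩ := exists_star_eq_involutive_central_mul hanti hcen hsq hsx g <;>
    have hw := (fun x => central_comm hc x) <;>
    have hw' := (fun x y => central_left_comm hc x y) <;>
    (try simp only [hanti, hinv, hg0s]) <;>
    (try simp only [mul_assoc, hs]) <;>
    simp only [hcc, hz g, hz h, hz k, hz (s h), hz' g, hz' h, hz' k, hz' (s h), hz' c, hw g, hw h, hw k,
      hw (s h), hw' g, hw' h, hw' k, hw' (s h), h2 g h, h2 g k, h2 g (s h), h2' g h, h2' g k,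
      h2' g (s h)]

set_option linter.unusedSimpArgs false in
theorem leftBolComponents_starMul_mul_mul
    (hinv : ∀ g, s (s g) = g) (hanti : ∀ g h, s (g * h) = s h * s g)
    (hcen : ∀ g, g * s g ∈ Subgroup.center G)
    (hg0 : g0 ∈ Subgroup.center G) (hg0s : s g0 = g0)
    (hsq : ∀ g : G, g ^ 2 ∈ Subgroup.center G) (hsx : ∀ x, s (x * x) = x * x) :
    LeftBolComponents (fun g h : G => s g * h) (fun g h : G => g * h)
      (fun g h : G => g0 * (g * h)) := by
  have hz := fun x => central_comm hg0 x
  have hz' := fun x y => central_left_comm hg0 x y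
  have h2 := fun g x => sq_comm hsq g x
  have h2' := fun g x y => sq_left_comm hsq g x y
  constructor <;> intro g h k <;>
    obtain ⟨c, hc, hs, hcc⟩ := exists_star_eq_involutive_central_mul hanti hcen hsq hsx g <;>
    have hw := (fun x => central_comm hc x) <;>
    have hw' := (fun x y => central_left_comm hc x y) <;>
    (try simp only [hanti, hinv, hg0s]) <;>
    (try simp only [mul_assoc, hs]) <;>
    simp only [hcc, hz g, hz h, hz k, hz (s h), hz' g, hz' h, hz' k, hz' (s h), hz' c, hw g, hw h, hw k,
      hw (s h), hw' g, hw' h, hw' k, hw' (s h), h2 g h, h2 g k, h2 g (s h), h2' g h, h2' g k,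
      h2' g (s h)]

set_option linter.unusedSimpArgs false in
theorem leftBolComponents_starMul_swap_swap
    (hinv : ∀ g, s (s g) = g) (hanti : ∀ g h, s (g * h) = s h * s g)
    (hcen : ∀ g, g * s g ∈ Subgroup.center G)
    (hg0 : g0 ∈ Subgroup.center G) (hg0s : s g0 = g0)
    (hsq : ∀ g : G, g ^ 2 ∈ Subgroup.center G) (hsx : ∀ x, s (x * x) = x * x) :
    LeftBolComponents (fun g h : G => s g * h) (fun g h : G => h * g)
      (fun g h : G => g0 * (h * g)) := by
  have hz := fun x => central_comm hg0 x
  have hz' := fun x y => central_left_comm hg0 x y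
  have h2 := fun g x => sq_comm hsq g x
  have h2' := fun g x y => sq_left_comm hsq g x y
  constructor <;> intro g h k <;>
    obtain ⟨c, hc, hs, hcc⟩ := exists_star_eq_involutive_central_mul hanti hcen hsq hsx g <;>
    have hw := (fun x => central_comm hc x) <;>
    have hw' := (fun x y => central_left_comm hc x y) <;>
    (try simp only [hanti, hinv, hg0s]) <;>
    (try simp only [mul_assoc, hs]) <;>
    simp only [hcc, hz g, hz h, hz k, hz (s h), hz' g, hz' h, hz' k, hz' (s h), hz' c, hw g, hw h, hw k,
      hw (s h), hw' g, hw' h, hw' k, hw' (s h), h2 g h, h2 g k, h2 g (s h), h2' g h, h2' g k,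
      h2' g (s h)]

theorem D_cases_of_C_mul {B D : G → G → G} (hanti : ∀ g h, s (g * h) = s h * s g)
    (hD : ∃ ε : G → G → G, IsBasic s ε ∧ D = fun g h => g0 * ε g h)
    (H : LeftBolComponents B (fun g h => g * h) D) :
    D = (fun g h => g0 * (g * h)) ∨ D = (fun g h => g0 * (s g * h)) := by
  have hr : ∀ h k, D h k = D h 1 * k := fun h k => by simpa using H.rrl 1 h k
  have h1 : (∀ h, D h 1 = g0 * h) ∨ (∀ h, D h 1 = g0 * s h) := by
    obtain ⟨ε, hε, rfl⟩ := hD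
    rcases hε with rfl | rfl | rfl | rfl | rfl | rfl | rfl | rfl <;>
      simp [antiautomorphism_one hanti]
  refine h1.imp (fun h1 => ?_) (fun h1 => ?_) <;>
    · funext g h
      rw [hr, h1, mul_assoc]

theorem D_cases_of_C_swap {B D : G → G → G} (hanti : ∀ g h, s (g * h) = s h * s g)
    (hg0 : g0 ∈ Subgroup.center G)
    (hD : ∃ ε : G → G → G, IsBasic s ε ∧ D = fun g h => g0 * ε g h)
    (H : LeftBolComponents B (fun g h => h * g) D) :
    D = (fun g h => g0 * (h * g)) ∨ D = (fun g h => g0 * (h * s g)) := by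
  have hr : ∀ h k, D h k = k * D h 1 := fun h k => by simpa using H.rrl 1 h k
  have h1 : (∀ h, D h 1 = g0 * h) ∨ (∀ h, D h 1 = g0 * s h) := by
    obtain ⟨ε, hε, rfl⟩ := hD
    rcases hε with rfl | rfl | rfl | rfl | rfl | rfl | rfl | rfl <;>
      simp [antiautomorphism_one hanti]
  refine h1.imp (fun h1 => ?_) (fun h1 => ?_) <;>
    · funext g h
      rw [hr, h1, central_left_comm hg0]

theorem B_cases_of_C_mul {B D : G → G → G}
    (hB : B = (fun g h => g * h) ∨ B = (fun g h => s g * h) ∨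
      B = (fun g h => h * g) ∨ B = (fun g h => h * s g))
    (H : LeftBolComponents B (fun g h => g * h) D) :
    B = (fun g h => g * h) ∨ B = (fun g h => s g * h) := by
  have hr : ∀ g k, B g k = B g 1 * k := fun g k => by simpa using H.lrl g g⁻¹ k
  have h1 : (∀ g, B g 1 = g) ∨ (∀ g, B g 1 = s g) := by
    rcases hB with rfl | rfl | rfl | rfl <;> simp
  refine h1.imp (fun h1 => ?_) (fun h1 => ?_) <;>
    · funext g h
      rw [hr, h1]

theorem B_cases_of_C_swap {B D : G → G → G}
    (hB : B = (fun g h => g * h) ∨ B = (fun g h => s g * h) ∨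
      B = (fun g h => h * g) ∨ B = (fun g h => h * s g))
    (H : LeftBolComponents B (fun g h => h * g) D) :
    B = (fun g h => g * h) ∨ B = (fun g h => s g * h) := by
  rcases hB with rfl | rfl | rfl | rfl
  · exact Or.inl rfl
  · exact Or.inr rfl
  · have hc : ∀ g k : G, g * k = k * g := fun g k => by simpa using H.lrl g g⁻¹ k
    exact Or.inl (funext₂ fun g h => hc h g)
  · have hc : ∀ g k : G, g * k = k * g := fun g k => by
      have h := H.lrl g 1 k
      simp only [mul_one, ← mul_assoc] at h
      exact mul_right_cancel h
    exact Or.inr (funext₂ fun g h => hc h (s g))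

theorem sq_mem_center_of_comm {g : G} (h : ∀ x, g * (g * x) = x * (g * g)) :
    g ^ 2 ∈ Subgroup.center G :=
  Subgroup.mem_center_iff.2 fun x => by simpa only [pow_two, mul_assoc] using (h x).symm

end CentralNorm

theorem statement_18 {G : Type*} [Group G] (s : G → G) (g0 : G)
    (hinv : ∀ g, s (s g) = g)
    (hanti : ∀ g h, s (g * h) = s h * s g)
    (hcen : ∀ g, g * s g ∈ Subgroup.center G)
    (hg0 : g0 ∈ Subgroup.center G) (hg0s : s g0 = g0)
    (hne : s ≠ id)
    (B C D : G → G → G)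
    (hB : B = (fun g h => g * h) ∨ B = (fun g h => s g * h) ∨
          B = (fun g h => h * g) ∨ B = (fun g h => h * s g))
    (hC : C = (fun g h => g * h) ∨ C = (fun g h => h * g))
    (hD : ∃ ε : G → G → G, IsBasic s ε ∧ D = fun g h => g0 * ε g h)
    (mul : G ⊕ G → G ⊕ G → G ⊕ G)
    (hmul : mul = Qmul (fun g h => g * h) B C D) :
    (∀ x y z, mul x (mul y (mul x z)) = mul (mul x (mul y x)) z) ↔
      ((∀ x y z, mul x (mul y (mul x z)) = mul (mul (mul x y) x) z) ∨
       ((∀ g : G, g ^ 2 ∈ Subgroup.center G) ∧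
          ((B = (fun g h => g * h) ∧ C = (fun g h => h * g) ∧
              D = (fun g h => g0 * (h * g))) ∨
           (B = (fun g h => s g * h) ∧ C = (fun g h => g * h) ∧
              D = (fun g h => g0 * (s g * h))))) ∨
       ((∀ a b : G, a * b = b * a) ∧ (∀ x : G, s (x * x) = x * x) ∧
          ((B = (fun g h => g * h) ∧ C = (fun g h => g * h) ∧
              D = (fun g h => g0 * (s g * h))) ∨
           (B = (fun g h => s g * h) ∧ C = (fun g h => g * h) ∧
              D = (fun g h => g0 * (g * h))))) ∨
       ((∀ g : G, g ^ 2 ∈ Subgroup.center G) ∧ (∀ x : G, s (x * x) = x * x) ∧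
          ((B = (fun g h => g * h) ∧ C = (fun g h => g * h) ∧
              D = (fun g h => g0 * (s g * h))) ∨
           (B = (fun g h => g * h) ∧ C = (fun g h => h * g) ∧
              D = (fun g h => g0 * (h * s g))) ∨
           (B = (fun g h => s g * h) ∧ C = (fun g h => g * h) ∧
              D = (fun g h => g0 * (g * h))) ∨
           (B = (fun g h => s g * h) ∧ C = (fun g h => h * g) ∧
              D = (fun g h => g0 * (h * g)))))) := by
  subst hmul
  rw [leftBol_Qmul_iff]
  have hz := fun x => central_comm hg0 x
  have hz' := fun x y => central_left_comm hg0 x y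
  have hs1 := antiautomorphism_one hanti
  constructor
  · intro H
    rcases hC with rfl | rfl
    · rcases B_cases_of_C_mul hB H with rfl | rfl <;>
        rcases D_cases_of_C_mul hanti hD H with rfl | rfl
      · left
        refine moufang_Qmul_of_flexible H ?_ ?_ ?_ <;> intro g h <;> simp [mul_assoc, hz']
      · have hsq : ∀ g : G, g ^ 2 ∈ Subgroup.center G := fun g =>
          sq_mem_center_of_swap hcen fun x => by
            simpa [mul_assoc, hz'] using H.rlr g x 1
        have hsx : ∀ x, s (x * x) = x * x := fun x => by
          simpa [hs1, hz', hanti] using (H.lrr x 1 1).symm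
        exact Or.inr (Or.inr (Or.inr ⟨hsq, hsx, Or.inl ⟨rfl, rfl, rfl⟩⟩))
      · have hsq : ∀ g : G, g ^ 2 ∈ Subgroup.center G := fun g =>
          sq_mem_center_of_swap hcen fun x => by
            simpa [mul_assoc, hz'] using H.lrr g x 1
        have hsx : ∀ x, s (x * x) = x * x := fun x => by
          simpa [hs1, hz', hanti, hinv, hg0s, mul_assoc, hz x, hz (s x)] using (H.rlr x 1 1).symm
        exact Or.inr (Or.inr (Or.inr ⟨hsq, hsx, Or.inr (Or.inr (Or.inl ⟨rfl, rfl, rfl⟩))⟩))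
      · have hsq : ∀ g : G, g ^ 2 ∈ Subgroup.center G := fun g =>
          sq_mem_center_of_swap hcen fun x => by
            simpa [mul_assoc, hz', hanti, hinv] using H.lrr g (s x) 1
        exact Or.inr (Or.inl ⟨hsq, Or.inr ⟨rfl, rfl, rfl⟩⟩)
    · rcases B_cases_of_C_swap hB H with rfl | rfl <;>
        rcases D_cases_of_C_swap hanti hg0 hD H with rfl | rfl
      · have hsq : ∀ g : G, g ^ 2 ∈ Subgroup.center G := fun g =>
          sq_mem_center_of_comm fun x => by simpa using H.lrl g 1 x
        exact Or.inr (Or.inl ⟨hsq, Or.inl ⟨rfl, rfl, rfl⟩⟩)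
      · have hsq : ∀ g : G, g ^ 2 ∈ Subgroup.center G := fun g =>
          sq_mem_center_of_comm fun x => by simpa using H.lrl g 1 x
        have hsx : ∀ x, s (x * x) = x * x := fun x => by
          simpa [hs1, hz', hanti] using (H.lrr x 1 1).symm
        exact Or.inr (Or.inr (Or.inr ⟨hsq, hsx, Or.inr (Or.inl ⟨rfl, rfl, rfl⟩)⟩))
      · have hsq : ∀ g : G, g ^ 2 ∈ Subgroup.center G := fun g =>
          sq_mem_center_of_comm fun x => by
            simpa [hs1, mul_assoc] using (H.rll g 1 x).symm
        have hsx : ∀ x, s (x * x) = x * x := fun x => by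
          simpa [hs1, hz', hanti, hinv, hg0s, mul_assoc, hz x, hz (s x)] using (H.rlr x 1 1).symm
        exact Or.inr (Or.inr (Or.inr ⟨hsq, hsx, Or.inr (Or.inr (Or.inr ⟨rfl, rfl, rfl⟩))⟩))
      · left
        refine moufang_Qmul_of_flexible H ?_ ?_ ?_ <;> intro g h
        · rw [← mul_assoc, ← mul_assoc, star_mul_self_comm hcen]
        · rw [hanti, ← mul_assoc g, mul_assoc (s h), central_comm (hcen g)]
        · rw [hanti, hanti, hinv, hg0s, hz]
  · rintro (H | ⟨hsq, ⟨rfl, rfl, rfl⟩ | ⟨rfl, rfl, rfl⟩⟩ |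
      ⟨hc, hsx, ⟨rfl, rfl, rfl⟩ | ⟨rfl, rfl, rfl⟩⟩ |
      ⟨hsq, hsx, ⟨rfl, rfl, rfl⟩ | ⟨rfl, rfl, rfl⟩ | ⟨rfl, rfl, rfl⟩ | ⟨rfl, rfl, rfl⟩⟩)
    · have he : ∀ x, Qmul (fun g h => g * h) B C D x (Sum.inl 1) = x := by
        rintro (g | g)
        · simp [Qmul]
        · rcases hC with rfl | rfl <;> simp [Qmul]
      exact (leftBol_Qmul_iff B C D).1 (leftBol_of_moufang he H)
    · exact leftBolComponents_mul_swap_swap hg0 hsq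
    · exact leftBolComponents_starMul_mul_starMul hinv hanti hcen hg0 hg0s hsq
    · have hsq : ∀ g : G, g ^ 2 ∈ Subgroup.center G := fun g =>
        Subgroup.mem_center_iff.2 fun x => hc x _
      exact leftBolComponents_mul_mul_starMul hinv hanti hcen hg0 hg0s hsq hsx
    · have hsq : ∀ g : G, g ^ 2 ∈ Subgroup.center G := fun g =>
        Subgroup.mem_center_iff.2 fun x => hc x _
      exact leftBolComponents_starMul_mul_mul hinv hanti hcen hg0 hg0s hsq hsx
    · exact leftBolComponents_mul_mul_starMul hinv hanti hcen hg0 hg0s hsq hsx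
    · exact leftBolComponents_mul_swap_swapStar hinv hanti hcen hg0 hg0s hsq hsx
    · exact leftBolComponents_starMul_mul_mul hinv hanti hcen hg0 hg0s hsq hsx
    · exact leftBolComponents_starMul_swap_swap hinv hanti hcen hg0 hg0s hsq hsx
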